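/- Let x, α, β, γ ∈ ℂ with (α,β,γ) ≠ (0,0,0) and x·α·β = γ². Then there exist u, v, w, λ ∈ ℂ with λ ≠ 0 and (v,w) ≠ (0,0) such that u² = x, v² = λ·α, w² = λ·β, and u·v·w = λ·γ. -/

import Mathlib

/-- Surjectivity of the map `ℂ × ℂP¹ → {xαβ = γ²} ⊂ ℂ × ℂP²`,
`(u,[v:w]) ↦ (u², [v² : w² : uvw])`: every point of the subvariety lifts,
up to a nonzero scalar `λ` on homogeneous coordinates. -/
theorem surjective_onto_Y (x α β γ : ℂ)
    (h0 : (α, β, γ) ≠ (0, 0, 0)) (h : x * α * β = γ ^ 2) :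
    ∃ u v w lam : ℂ, lam ≠ 0 ∧ (v, w) ≠ (0, 0) ∧
      u ^ 2 = x ∧ v ^ 2 = lam * α ∧ w ^ 2 = lam * β ∧ u * v * w = lam * γ := by
  obtain ⟨u, hu⟩ := IsAlgClosed.exists_pow_nat_eq x two_pos
  obtain ⟨v, hv⟩ := IsAlgClosed.exists_pow_nat_eq α two_pos
  obtain ⟨w, hw⟩ := IsAlgClosed.exists_pow_nat_eq β two_pos
  have hvw : (v, w) ≠ (0, 0) := by
    intro hvw
    obtain ⟨rfl, rfl⟩ := Prod.mk.inj hvw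
    have hα : α = 0 := by simpa using hv.symm
    have hβ : β = 0 := by simpa using hw.symm
    have hγ : γ = 0 := by simpa [hα] using h.symm
    exact h0 (by rw [hα, hβ, hγ])
  have hsq : (u * v * w) ^ 2 = γ ^ 2 := by
    rw [← h, ← hu, ← hv, ← hw]
    ring
  rcases sq_eq_sq_iff_eq_or_eq_neg.mp hsq with hγ | hγ
  · exact ⟨u, v, w, 1, one_ne_zero, hvw, hu, by simpa using hv, by simpa using hw,
      by simpa using hγ⟩
  · exact ⟨-u, v, w, 1, one_ne_zero, hvw, by simpa using hu, by simpa using hv,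
      by simpa using hw, by linear_combination -hγ⟩
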